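/- arXiv:1310.1561 — 4 statements merged into one kernel-verified Lean document; each statement's English description precedes it below -/
import Mathlib

section
/- Let G be a subgroup of GL_n(ℂ) (with the topology induced from GL_n(ℂ)) that has a dense conjugacy class, i.e., there is A ∈ G such that {B A B⁻¹ : B ∈ G} is dense in G. Then every element B of G has characteristic polynomial (t − 1)^n; equivalently, (B − Id)^n = 0 as an n × n complex matrix. -/
open Matrix Polynomial

theorem continuous_eval_charpoly {n : ℕ} (z : ℂ) :
    Continuous fun M : Matrix (Fin n) (Fin n) ℂ => M.charpoly.eval z := by
  simp only [Matrix.eval_charpoly]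
  exact (continuous_const.sub continuous_id).matrix_det

/-- In a linear group with a dense conjugacy class, all characteristic polynomials agree. -/
theorem charpoly_eq_of_dense_conjClass {n : ℕ} (G : Subgroup (GL (Fin n) ℂ))
    (A : ↥G) (hdense : Dense {x : ↥G | ∃ B : ↥G, B * A * B⁻¹ = x}) (B : ↥G) :
    ((B : GL (Fin n) ℂ) : Matrix (Fin n) (Fin n) ℂ).charpoly =
      ((A : GL (Fin n) ℂ) : Matrix (Fin n) (Fin n) ℂ).charpoly := by
  refine Polynomial.funext fun z => ?_
  have hcont : Continuous fun C : ↥G =>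
      ((C : GL (Fin n) ℂ) : Matrix (Fin n) (Fin n) ℂ).charpoly.eval z :=
    (continuous_eval_charpoly z).comp (Units.continuous_val.comp continuous_subtype_val)
  have heq := hcont.ext_on hdense (continuous_const (y := eval z
    ((A : GL (Fin n) ℂ) : Matrix (Fin n) (Fin n) ℂ).charpoly)) (by
      rintro _ ⟨C, rfl⟩
      simp only [Subgroup.coe_mul, Subgroup.coe_inv, Units.val_mul, Matrix.coe_units_inv]
      rw [Matrix.charpoly_units_conj])
  exact congrFun heq B

theorem stmt11 {n : ℕ} (G : Subgroup (GL (Fin n) ℂ))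
    (A : ↥G) (hdense : Dense {x : ↥G | ∃ B : ↥G, B * A * B⁻¹ = x}) :
    ∀ B : ↥G,
      Matrix.charpoly ((B : GL (Fin n) ℂ) : Matrix (Fin n) (Fin n) ℂ) = (X - 1) ^ n ∧
      (((B : GL (Fin n) ℂ) : Matrix (Fin n) (Fin n) ℂ) - 1) ^ n = 0 := by
  intro B
  have h : Matrix.charpoly ((B : GL (Fin n) ℂ) : Matrix (Fin n) (Fin n) ℂ) = (X - 1) ^ n := by
    rw [charpoly_eq_of_dense_conjClass G A hdense B,
      ← charpoly_eq_of_dense_conjClass G A hdense 1]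
    simp [Matrix.charpoly_one]
  refine ⟨h, ?_⟩
  simpa [h] using Matrix.aeval_self_charpoly ((B : GL (Fin n) ℂ) : Matrix (Fin n) (Fin n) ℂ)
end

section
/- Let G be a subgroup of GL_n(ℂ) (with the topology induced from GL_n(ℂ)) that has a dense conjugacy class, i.e., there is A ∈ G such that {B A B⁻¹ : B ∈ G} is dense in G. Then for all B, C ∈ G, the trace Tr(C(B − Id)) equals 0, where the product and difference are computed in the ring of n × n complex matrices. -/
open Matrix

theorem trace_eq_of_dense_conjClass {n : ℕ} (G : Subgroup (GL (Fin n) ℂ))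
    (A : ↥G) (hdense : Dense {x : ↥G | ∃ B : ↥G, B * A * B⁻¹ = x}) (x : ↥G) :
    Matrix.trace ((x : GL (Fin n) ℂ) : Matrix (Fin n) (Fin n) ℂ) =
      Matrix.trace ((A : GL (Fin n) ℂ) : Matrix (Fin n) (Fin n) ℂ) := by
  have hcont : Continuous fun x : ↥G =>
      Matrix.trace ((x : GL (Fin n) ℂ) : Matrix (Fin n) (Fin n) ℂ) :=
    (Units.continuous_val.comp continuous_subtype_val).matrix_trace
  refine congrFun (hcont.ext_on hdense continuous_const ?_) x
  rintro _ ⟨B, rfl⟩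
  exact Matrix.trace_units_conj (B : GL (Fin n) ℂ) _

theorem stmt12 {n : ℕ} (G : Subgroup (GL (Fin n) ℂ))
    (A : ↥G) (hdense : Dense {x : ↥G | ∃ B : ↥G, B * A * B⁻¹ = x}) :
    ∀ B C : ↥G,
      Matrix.trace (((C : GL (Fin n) ℂ) : Matrix (Fin n) (Fin n) ℂ) *
        (((B : GL (Fin n) ℂ) : Matrix (Fin n) (Fin n) ℂ) - 1)) = 0 := by
  intro B C
  rw [mul_sub, mul_one, Matrix.trace_sub, sub_eq_zero]
  exact (trace_eq_of_dense_conjClass G A hdense (C * B)).trans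
    (trace_eq_of_dense_conjClass G A hdense C).symm
end

section
/- Let G be a closed subgroup of GL_n(ℂ) that has a dense conjugacy class, i.e., there is A ∈ G such that {B A B⁻¹ : B ∈ G} is dense in G (in the subspace topology). Then G = {Id} is the trivial group. -/
open Matrix

theorem Module.End.isNilpotent_of_trace_pow_succ_eq_zero {K V : Type*} [Field K] [CharZero K]
    [AddCommGroup V] [Module K V] [FiniteDimensional K V] (f : Module.End K V)
    (h : ∀ k : ℕ, LinearMap.trace K V (f ^ (k + 1)) = 0) : IsNilpotent f := by
  have hp0 : minpoly K f ≠ 0 := minpoly.ne_zero (Algebra.IsIntegral.isIntegral f)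
  obtain ⟨q, hq, hqX⟩ :=
    Polynomial.exists_eq_pow_rootMultiplicity_mul_and_not_dvd (minpoly K f) hp0 0
  rw [Polynomial.C_0, sub_zero] at hq hqX
  set k := Polynomial.rootMultiplicity 0 (minpoly K f)
  have hcop : IsCoprime ((Polynomial.X : Polynomial K) ^ (k + 1)) q :=
    ((Polynomial.irreducible_X.coprime_iff_not_dvd).2 hqX).pow_left
  obtain ⟨a, b, hab⟩ := hcop
  have hann : Polynomial.aeval f (Polynomial.X ^ k * q) = 0 := by rw [← hq, minpoly.aeval]
  have htr : ∀ p : Polynomial K,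
      LinearMap.trace K V (Polynomial.aeval f (p * Polynomial.X)) = 0 := by
    intro p
    induction p using Polynomial.induction_on' with
    | add p q hp hq => rw [add_mul, map_add, map_add, hp, hq, add_zero]
    | monomial m c =>
      rw [Polynomial.monomial_mul_X, Polynomial.aeval_monomial, ← Algebra.smul_def, map_smul, h,
        smul_zero]
  set e := Polynomial.aeval f (a * Polynomial.X ^ (k + 1)) with he
  have hidem : IsIdempotentElem e := by
    have : a * Polynomial.X ^ (k + 1) * (a * Polynomial.X ^ (k + 1)) =
        a * Polynomial.X ^ (k + 1) -
          (a * Polynomial.X * b) * (Polynomial.X ^ k * q) := by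
      linear_combination (a * Polynomial.X ^ (k + 1)) * hab
    rw [IsIdempotentElem, he, ← map_mul, this, map_sub, map_mul _ (a * _ * b), hann, mul_zero,
      sub_zero]
  have he0 : e = 0 := by
    refine LinearMap.IsIdempotentElem.eq_zero_of_trace_eq_zero hidem ?_
    rw [he, pow_succ, ← mul_assoc]
    exact htr _
  refine ⟨k, ?_⟩
  have hX : (Polynomial.X : Polynomial K) ^ k =
      Polynomial.X ^ k * (a * Polynomial.X ^ (k + 1)) + b * (Polynomial.X ^ k * q) := by
    linear_combination -(Polynomial.X ^ k) * hab
  have := congrArg (Polynomial.aeval f) hX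
  rwa [map_add, map_mul, map_mul _ b, hann, ← he, he0, mul_zero, mul_zero, add_zero,
    Polynomial.aeval_X_pow] at this

theorem Submodule.eq_bot_of_le_mul_self_of_isNilpotent {K V : Type*} [Field K]
    [AddCommGroup V] [Module K V] [FiniteDimensional K V] (L : Submodule K (Module.End K V))
    (hmul : L * L ≤ L) (hnil : ∀ x ∈ L, IsNilpotent x) (hle : L ≤ L * L) : L = ⊥ := by
  let _ : LieRing (Module.End K V) := LieRing.ofAssociativeRing
  let L' : LieSubalgebra K (Module.End K V) :=
    { L with
      lie_mem' := fun {x y} hx hy => by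
        rw [Ring.lie_def]
        exact L.sub_mem (hmul (Submodule.mul_mem_mul hx hy)) (hmul (Submodule.mul_mem_mul hy hx)) }
  have hN : LieModule.IsNilpotent L' V := by
    rw [LieModule.isNilpotent_iff_forall (R := K)]
    exact fun x => hnil x x.2
  obtain ⟨k, hk⟩ := (LieModule.isNilpotent_iff K L' V).1 hN
  have key : ∀ k, ∀ x ∈ L, ∀ v, x v ∈ LieModule.lowerCentralSeries K L' V k := by
    intro k
    induction k with
    | zero => simp
    | succ k ih =>
      intro x hx v
      induction hle hx using Submodule.mul_induction_on' with
      | mem_mul_mem a ha b hb =>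
        rw [LieModule.lowerCentralSeries_succ]
        exact LieSubmodule.lie_mem_lie (LieSubmodule.mem_top (⟨a, ha⟩ : L')) (ih b hb v)
      | add a ha b hb iha ihb =>
        rw [LinearMap.add_apply]
        exact add_mem (iha (hmul ha)) (ihb (hmul hb))
  refine (Submodule.eq_bot_iff _).2 fun x hx => LinearMap.ext fun v => ?_
  have := key k x hx v
  rwa [hk, LieSubmodule.mem_bot] at this

theorem Matrix.submodule_eq_bot_of_le_mul_self {K ι : Type*} [Field K] [CharZero K]
    [Fintype ι] [DecidableEq ι] (L : Submodule K (Matrix ι ι K))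
    (hmul : L * L ≤ L) (htr : ∀ x ∈ L, x.trace = 0) (hle : L ≤ L * L) : L = ⊥ := by
  let φ : Matrix ι ι K →ₐ[K] Module.End K (ι → K) := Matrix.toLinAlgEquiv'.toAlgHom
  have hφ : Function.Injective φ := Matrix.toLinAlgEquiv'.injective
  have hpow : ∀ x ∈ L, ∀ k : ℕ, x ^ (k + 1) ∈ L := by
    intro x hx k
    induction k with
    | zero => simpa using hx
    | succ k ih => exact hmul (pow_succ x (k + 1) ▸ Submodule.mul_mem_mul ih hx)
  have hmap := Submodule.map_mul L L φ
  have hbot : L.map φ.toLinearMap = ⊥ := by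
    refine Submodule.eq_bot_of_le_mul_self_of_isNilpotent _
      (hmap ▸ Submodule.map_mono hmul) ?_ (hmap ▸ Submodule.map_mono hle)
    rintro _ ⟨x, hx, rfl⟩
    refine Module.End.isNilpotent_of_trace_pow_succ_eq_zero _ fun k => ?_
    rw [AlgHom.toLinearMap_apply, ← map_pow]
    exact (Matrix.trace_toLin'_eq _).trans (htr _ (hpow x hx k))
  exact Submodule.map_injective_of_injective hφ (hbot.trans (Submodule.map_bot _).symm)

theorem stmt13 {n : ℕ} (G : Subgroup (GL (Fin n) ℂ))
    (hclosed : IsClosed (G : Set (GL (Fin n) ℂ)))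
    (A : ↥G) (hdense : Dense {x : ↥G | ∃ B : ↥G, B * A * B⁻¹ = x}) :
    G = ⊥ := by
  let c : ↥G →* Matrix (Fin n) (Fin n) ℂ := (Units.coeHom _).comp G.subtype
  have hc : Continuous c := Units.continuous_val.comp continuous_subtype_val
  have hind : ∀ S : Set (Matrix (Fin n) (Fin n) ℂ), IsClosed S →
      (∀ B : ↥G, c (B * A * B⁻¹) ∈ S) → ∀ g, c g ∈ S := by
    intro S hS h g
    have hsub : closure {x : ↥G | ∃ B : ↥G, B * A * B⁻¹ = x} ⊆ c ⁻¹' S :=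
      closure_minimal (by rintro _ ⟨B, rfl⟩; exact h B) (hS.preimage hc)
    exact hsub (hdense g)
  have htrA : ∀ g, (c g).trace = (c A).trace := by
    refine hind {M | M.trace = (c A).trace}
      (isClosed_eq continuous_id.matrix_trace continuous_const) fun B => ?_
    rw [Set.mem_ofPred_eq, map_mul, Matrix.trace_mul_comm, ← map_mul, inv_mul_cancel_left]
  set L : Submodule ℂ (Matrix (Fin n) (Fin n) ℂ) :=
    Submodule.span ℂ (Set.range fun g => c g - 1) with hL
  have hmem : ∀ g, c g - 1 ∈ L := fun g => Submodule.subset_span ⟨g, rfl⟩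
  have hmul : L * L ≤ L := by
    rw [hL, Submodule.span_mul_span, ← hL, Submodule.span_le]
    rintro _ ⟨_, ⟨g, rfl⟩, _, ⟨h, rfl⟩, rfl⟩
    have : (c g - 1) * (c h - 1) = (c (g * h) - 1) - (c g - 1) - (c h - 1) := by
      rw [map_mul]; noncomm_ring
    simp only [SetLike.mem_coe, this]
    exact sub_mem (sub_mem (hmem _) (hmem _)) (hmem _)
  have htr : ∀ x ∈ L, x.trace = 0 := by
    have : L ≤ LinearMap.ker (Matrix.traceLinearMap (Fin n) ℂ ℂ) := by
      rw [hL, Submodule.span_le]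
      rintro _ ⟨g, rfl⟩
      simp only [SetLike.mem_coe, LinearMap.mem_ker, Matrix.traceLinearMap_apply]
      rw [Matrix.trace_sub, htrA g, ← htrA 1, map_one, sub_self]
    exact this
  have hcoset : ∀ g, c g - c A ∈ L * L := by
    refine hind {M | M - c A ∈ L * L}
      ((Submodule.closed_of_finiteDimensional (L * L)).preimage
        (continuous_id.sub continuous_const)) fun B => ?_
    have hB : c B * c B⁻¹ = 1 := by rw [← map_mul, mul_inv_cancel, map_one]
    have : c (B * A * B⁻¹) - c A = (c B - 1) * (c A - 1)
        + (c (B * A) - 1 - (c B - 1)) * (c B⁻¹ - 1) := by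
      rw [map_mul, map_mul]
      linear_combination (norm := noncomm_ring) hB
    rw [Set.mem_ofPred_eq, this]
    exact add_mem (Submodule.mul_mem_mul (hmem _) (hmem _))
      (Submodule.mul_mem_mul (sub_mem (hmem _) (hmem _)) (hmem _))
  have hle : L ≤ L * L := by
    rw [hL, Submodule.span_le, ← hL]
    rintro _ ⟨g, rfl⟩
    have := sub_mem (hcoset g) (hcoset 1)
    rwa [sub_sub_sub_cancel_right, map_one] at this
  have hbot := Matrix.submodule_eq_bot_of_le_mul_self L hmul htr hle
  refine (Subgroup.eq_bot_iff_forall G).2 fun g hg => Units.ext ?_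
  have := hmem ⟨g, hg⟩
  rw [hbot, Submodule.mem_bot, sub_eq_zero] at this
  exact this
end

section
/- Let D₆ be the dihedral group of order 6, with rotations r^j and reflections s r^j (j = 0, 1, 2). In the product group D₆^ℕ (with the product topology), let G be the set of sequences α such that either every coordinate α(i) is a rotation or every coordinate α(i) is a reflection, let H ⊆ G be the set of sequences all of whose coordinates are rotations, and let β ∈ G be the sequence constantly equal to s. Then G is a subgroup of D₆^ℕ, and the conjugacy class of β in G, {α β α⁻¹ : α ∈ G}, equals G \ H; in particular, this conjugacy class is an open subset of G (with the subspace topology from D₆^ℕ). -/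
namespace DihedralGroup

/-- The sequences in a dihedral group that consist of rotations only or of reflections only. -/
def constantTypeSubgroup (ι : Type*) (n : ℕ) : Subgroup (ι → DihedralGroup n) where
  carrier := {α | (∀ i, ∃ j : ZMod n, α i = r j) ∨ (∀ i, ∃ j : ZMod n, α i = sr j)}
  one_mem' := Or.inl fun _ => ⟨0, rfl⟩
  mul_mem' := by
    rintro a b (ha | ha) (hb | hb) <;> choose f hf using ha <;> choose g hg using hb
    · exact Or.inl fun i => ⟨f i + g i, by simp [hf, hg]⟩
    · exact Or.inr fun i => ⟨g i - f i, by simp [hf, hg]⟩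
    · exact Or.inr fun i => ⟨f i + g i, by simp [hf, hg]⟩
    · exact Or.inl fun i => ⟨g i - f i, by simp [hf, hg]⟩
  inv_mem' := by
    rintro a (ha | ha) <;> choose f hf using ha
    · exact Or.inl fun i => ⟨-f i, by simp [hf]⟩
    · exact Or.inr fun i => ⟨f i, by simp [hf]⟩

theorem r_mul_sr_zero_mul_r_inv (j : ZMod 3) : r j * sr 0 * (r j)⁻¹ = sr j := by
  revert j; decide

theorem exists_sr_eq_conj_sr_zero (x : DihedralGroup 3) : ∃ j, x * sr 0 * x⁻¹ = sr j := by
  cases x <;> simp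

theorem isOpen_setOf_apply_eq_sr {ι : Type*} {n : ℕ} [TopologicalSpace (DihedralGroup n)]
    [DiscreteTopology (DihedralGroup n)] (i : ι) :
    IsOpen {α : ι → DihedralGroup n | ∃ j, α i = sr j} := by
  have happly : Continuous fun α : ι → DihedralGroup n => α i := continuous_apply i
  exact (isOpen_discrete {x : DihedralGroup n | ∃ j, x = sr j}).preimage happly

end DihedralGroup

theorem stmt19 [TopologicalSpace (DihedralGroup 3)] [DiscreteTopology (DihedralGroup 3)]
    (Gset Hset : Set (ℕ → DihedralGroup 3))
    (hG : Gset = {α | (∀ i, ∃ j : ZMod 3, α i = DihedralGroup.r j) ∨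
                      (∀ i, ∃ j : ZMod 3, α i = DihedralGroup.sr j)})
    (hH : Hset = {α | ∀ i, ∃ j : ZMod 3, α i = DihedralGroup.r j})
    (β : ℕ → DihedralGroup 3) (hβ : β = fun _ => DihedralGroup.sr 0) :
    (∃ S : Subgroup (ℕ → DihedralGroup 3), (S : Set (ℕ → DihedralGroup 3)) = Gset) ∧
    {x | ∃ α ∈ Gset, α * β * α⁻¹ = x} = Gset \ Hset ∧
    IsOpen (Subtype.val ⁻¹' {x | ∃ α ∈ Gset, α * β * α⁻¹ = x} : Set ↥Gset) := by
  subst hG hH hβ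
  have hclass : {x : ℕ → DihedralGroup 3 | ∃ α ∈ {α : ℕ → DihedralGroup 3 |
      (∀ i, ∃ j : ZMod 3, α i = DihedralGroup.r j) ∨ (∀ i, ∃ j : ZMod 3, α i = DihedralGroup.sr j)},
      α * (fun _ => DihedralGroup.sr 0) * α⁻¹ = x} =
      {x | ∀ i, ∃ j : ZMod 3, x i = DihedralGroup.sr j} := by
    ext x
    constructor
    · rintro ⟨α, -, rfl⟩ i
      exact DihedralGroup.exists_sr_eq_conj_sr_zero (α i)
    · intro hx
      choose f hf using hx
      refine ⟨fun i => DihedralGroup.r (f i), Or.inl fun i => ⟨f i, rfl⟩, funext fun i => ?_⟩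
      rw [hf i]
      exact DihedralGroup.r_mul_sr_zero_mul_r_inv (f i)
  rw [hclass]
  refine ⟨⟨DihedralGroup.constantTypeSubgroup ℕ 3, rfl⟩, ?_, ?_⟩
  · ext x
    refine ⟨fun hx => ⟨Or.inr hx, fun hr => ?_⟩, fun hx => hx.1.resolve_left hx.2⟩
    obtain ⟨j, hj⟩ := hx 0
    obtain ⟨k, hk⟩ := hr 0
    simp [hj] at hk
  · convert (DihedralGroup.isOpen_setOf_apply_eq_sr (n := 3) (0 : ℕ)).preimage
      continuous_subtype_val using 1
    ext ⟨x, hx⟩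
    refine ⟨fun h => h 0, fun ⟨j, hj⟩ => hx.resolve_left fun hr => ?_⟩
    obtain ⟨k, hk⟩ := hr 0
    exact nomatch hj.symm.trans hk
end
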